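/- arXiv:2209.02956 — 4 statements merged into one kernel-verified Lean document; each statement's English description precedes it below -/
import Mathlib

section
/- A bounded holomorphic mapping f : U → F has relatively compact range f(U) if and only if there exist a complex Banach space G, a compact bounded linear operator T : G → F and a bounded holomorphic mapping g : U → G such that f(x) = T(g(x)) for all x ∈ U. -/
open Set Metric Filter Topology Pointwise Real

section Hull

variable {F : Type*} [NormedAddCommGroup F] [NormedSpace ℂ F]

theorem Balanced.convexHull_real {s : Set F} (hs : Balanced ℂ s) :
    Balanced ℂ (convexHull ℝ s) := by
  rw [balanced_iff_smul_mem]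
  intro a ha x hx
  have hconv : Convex ℝ ((fun y : F => a • y) ⁻¹' convexHull ℝ s) :=
    (convex_convexHull ℝ s).is_linear_preimage
      ⟨fun _ _ => smul_add _ _ _, fun _ _ => smul_comm _ _ _⟩
  exact convexHull_min (fun y hy => mem_preimage.mpr (subset_convexHull ℝ s (hs.smul_mem ha hy)))
    hconv hx

/-- A relatively compact set is contained in a compact, convex and balanced set. -/
theorem IsCompact.exists_isCompact_convex_balanced_superset [CompleteSpace F] {s : Set F}
    (hs : IsCompact (closure s)) :
    ∃ K : Set F, IsCompact K ∧ Convex ℝ K ∧ Balanced ℂ K ∧ s ⊆ K := by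
  have hc : IsCompact (closedBall (0 : ℂ) 1 • closure s) :=
    (isCompact_closedBall (0 : ℂ) 1).smul_set hs
  have hbal : Balanced ℂ (closedBall (0 : ℂ) 1 • closure s) := by
    rw [balanced_iff_smul_mem]
    rintro a ha _ ⟨b, hb, x, hx, rfl⟩
    refine ⟨a * b, ?_, x, hx, mul_smul _ _ _⟩
    rw [mem_closedBall_zero_iff] at hb ⊢
    rw [norm_mul]
    exact mul_le_one₀ ha (norm_nonneg b) hb
  refine ⟨closure (convexHull ℝ (closedBall (0 : ℂ) 1 • closure s)),
    hc.totallyBounded.convexHull.closure.isCompact_of_isClosed isClosed_closure,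
    (convex_convexHull ℝ _).closure, hbal.convexHull_real.closure, fun x hx => ?_⟩
  exact subset_closure (subset_convexHull ℝ _ ⟨1, by simp, x, subset_closure hx, one_smul _ _⟩)

theorem Balanced.sum_smul_mem {ι : Type*} {K : Set F} (hK : Balanced ℂ K) (hconv : Convex ℝ K)
    (h0 : (0 : F) ∈ K) {y : ι → F} (hy : ∀ i, y i ∈ K) (a : ι → ℂ) (s : Finset ι) :
    ∑ i ∈ s, a i • y i ∈ (∑ i ∈ s, ‖a i‖) • K := by
  classical
  induction s using Finset.induction_on with
  | empty => simpa using zero_mem_smul_set h0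
  | insert i s hi ih =>
    rw [Finset.sum_insert hi, Finset.sum_insert hi,
      hconv.add_smul (norm_nonneg _) (Finset.sum_nonneg fun _ _ => norm_nonneg _)]
    exact add_mem_add (hK.smul_mono (b := ‖a i‖) (by simp) (smul_mem_smul_set (hy i))) ih

end Hull

section Cauchy

variable {F : Type*} [NormedAddCommGroup F] [NormedSpace ℂ F] [CompleteSpace F]

theorem circleIntegral_smul_mem_smul {K : Set F} (hK : IsCompact K) (hconv : Convex ℝ K)
    (hbal : Balanced ℂ K) {φ : ℂ → F} {c : ℂ → ℂ} {ρ M : ℝ} (hρ : 0 < ρ)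
    (hφ : ContinuousOn φ (sphere 0 ρ)) (hφK : ∀ w ∈ sphere (0 : ℂ) ρ, φ w ∈ K)
    (hc : ContinuousOn c (sphere 0 ρ)) (hcM : ∀ w ∈ sphere (0 : ℂ) ρ, ‖w * c w‖ ≤ M) :
    ((2 * π * Complex.I)⁻¹ : ℂ) • (∮ w in C(0, ρ), c w • φ w) ∈ M • K := by
  have hM : 0 ≤ M := (norm_nonneg _).trans (hcM (ρ : ℂ) (by simp [hρ.le]))
  have hne : ∀ w ∈ sphere (0 : ℂ) ρ, w ≠ 0 := fun w hw h => by
    simp [h] at hw; exact hρ.ne hw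
  have h1 : (∮ w in C(0, ρ), c w • φ w) =
      ∮ w in C(0, ρ), (w - 0)⁻¹ • ((w * c w) • φ w) := by
    refine circleIntegral.integral_congr hρ.le fun w hw => ?_
    simp only [sub_zero, smul_smul]
    rw [inv_mul_cancel_left₀ (hne w hw)]
  rw [h1, ← circleAverage_eq_circleIntegral hρ.ne', circleAverage_eq_intervalAverage]
  have hcont : Continuous fun θ : ℝ =>
      (circleMap 0 ρ θ * c (circleMap 0 ρ θ)) • φ (circleMap 0 ρ θ) := by
    have hcm : ContinuousOn (fun w => (w * c w) • φ w) (sphere 0 ρ) :=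
      (continuousOn_id.mul hc).smul hφ
    exact hcm.comp_continuous (continuous_circleMap 0 ρ) fun θ => circleMap_mem_sphere 0 hρ.le θ
  refine (hconv.smul M).set_average_mem (hK.smul M).isClosed ?_ ?_ ?_ ?_
  · simp [uIoc_of_le two_pi_pos.le, pi_pos]
  · simp [uIoc_of_le two_pi_pos.le, ENNReal.mul_eq_top]
  · refine Eventually.of_forall fun θ => ?_
    have hθ := circleMap_mem_sphere (0 : ℂ) hρ.le θ
    exact hbal.smul_mono (b := M) ((hcM _ hθ).trans (le_abs_self M))
      (smul_mem_smul_set (hφK _ hθ))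
  · exact intervalIntegrable_iff.mp (hcont.intervalIntegrable 0 (2 * π))

/-- Cauchy's estimate for the first derivative, with a compact convex balanced set as bound. -/
theorem deriv_mem_smul {K : Set F} (hK : IsCompact K) (hconv : Convex ℝ K)
    (hbal : Balanced ℂ K) {φ : ℂ → F} {ρ : ℝ} (hρ : 0 < ρ)
    (hφ : DifferentiableOn ℂ φ (closedBall 0 ρ)) (hφK : ∀ w ∈ sphere (0 : ℂ) ρ, φ w ∈ K) :
    deriv φ 0 ∈ ρ⁻¹ • K := by
  have hne : ∀ w ∈ sphere (0 : ℂ) ρ, w ≠ 0 := fun w hw h => by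
    simp [h] at hw; exact hρ.ne hw
  have h := circleIntegral_smul_mem_smul hK hconv hbal (c := fun w => 1 / (w - 0) ^ 2) (M := ρ⁻¹)
    hρ (hφ.continuousOn.mono sphere_subset_closedBall) hφK
    (continuousOn_const.div (by fun_prop) fun w hw => by simpa using hne w hw) fun w hw => by
      have hw' : ‖w‖ = ρ := by simpa using hw
      simp only [sub_zero, norm_mul, norm_div, norm_one, norm_pow, hw']
      apply le_of_eq
      field_simp
  rwa [hφ.deriv_eq_smul_circleIntegral hρ, inv_smul_smul₀ Complex.two_pi_I_ne_zero] at h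

/-- Cauchy's estimate for the second order Taylor remainder, with a compact convex balanced set as
bound. -/
theorem sub_sub_deriv_mem_smul {K : Set F} (hK : IsCompact K) (hconv : Convex ℝ K)
    (hbal : Balanced ℂ K) {φ : ℂ → F} {ρ : ℝ} (hρ : 2 ≤ ρ)
    (hφ : DifferentiableOn ℂ φ (closedBall 0 ρ)) (hφK : ∀ w ∈ sphere (0 : ℂ) ρ, φ w ∈ K) :
    φ 1 - φ 0 - deriv φ 0 ∈ (2 / ρ ^ 2) • K := by
  have hρ0 : 0 < ρ := by linarith
  have hne : ∀ w ∈ sphere (0 : ℂ) ρ, w ≠ 0 := fun w hw h => by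
    simp [h] at hw; exact hρ0.ne hw
  have hne1 : ∀ w ∈ sphere (0 : ℂ) ρ, w - 1 ≠ 0 := fun w hw h => by
    rw [sub_eq_zero.mp h] at hw
    simp at hw
    linarith
  have hφc := hφ.continuousOn.mono sphere_subset_closedBall
  have c1 : ContinuousOn (fun w : ℂ => (w - 1)⁻¹) (sphere 0 ρ) :=
    ContinuousOn.inv₀ (by fun_prop) hne1
  have c2 : ContinuousOn (fun w : ℂ => (w - 0)⁻¹) (sphere 0 ρ) :=
    ContinuousOn.inv₀ (by fun_prop) fun w hw => by simpa using hne w hw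
  have c3 : ContinuousOn (fun w : ℂ => 1 / (w - 0) ^ 2) (sphere 0 ρ) :=
    continuousOn_const.div (by fun_prop) fun w hw => by simpa using hne w hw
  have h := circleIntegral_smul_mem_smul hK hconv hbal
    (c := fun w => (w - 1)⁻¹ - (w - 0)⁻¹ - 1 / (w - 0) ^ 2) (M := 2 / ρ ^ 2)
    hρ0 hφc hφK ((c1.sub c2).sub c3) fun w hw => by
      have hw' : ‖w‖ = ρ := by simpa using hw
      have hw1 : ρ / 2 ≤ ‖w - 1‖ := by
        have := norm_sub_norm_le w 1
        rw [hw', norm_one] at this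
        linarith
      have hid : w * ((w - 1)⁻¹ - (w - 0)⁻¹ - 1 / (w - 0) ^ 2) = 1 / (w * (w - 1)) := by
        have := hne w hw
        have := hne1 w hw
        rw [sub_zero]
        field_simp
        ring
      rw [hid, norm_div, norm_mul, norm_one, hw',
        show 2 / ρ ^ 2 = 1 / (ρ * (ρ / 2)) by field_simp]
      gcongr
  have i1 : CircleIntegrable (fun w => (w - 1)⁻¹ • φ w) 0 ρ := (c1.smul hφc).circleIntegrable hρ0.le
  have i2 : CircleIntegrable (fun w => (w - 0)⁻¹ • φ w) 0 ρ := (c2.smul hφc).circleIntegrable hρ0.le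
  have i3 : CircleIntegrable (fun w => (1 / (w - 0) ^ 2) • φ w) 0 ρ :=
    (c3.smul hφc).circleIntegrable hρ0.le
  simp only [sub_smul] at h
  rw [circleIntegral.integral_sub (i1.fun_sub i2) i3, circleIntegral.integral_sub i1 i2,
    hφ.deriv_eq_smul_circleIntegral hρ0, hφ.circleIntegral_sub_inv_smul (by simp; linarith),
    hφ.circleIntegral_sub_inv_smul (by simpa using hρ0), ← smul_sub, ← smul_sub,
    inv_smul_smul₀ Complex.two_pi_I_ne_zero] at h
  exact h

end Cauchy

section Factorization

variable {E F G : Type*} [NormedAddCommGroup E] [NormedSpace ℂ E]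
  [NormedAddCommGroup F] [NormedSpace ℂ F] [CompleteSpace F]
  [NormedAddCommGroup G] [NormedSpace ℂ G]

/-- If `T` is injective and maps the unit ball onto a set containing the compact convex balanced
set `K`, then every lift through `T` of a holomorphic map with values in `K` is holomorphic. -/
theorem differentiableOn_of_comp_injective {K : Set F} (hK : IsCompact K) (hconv : Convex ℝ K)
    (hbal : Balanced ℂ K) {T : G →L[ℂ] F} (hT : Function.Injective T)
    (hKT : K ⊆ T '' closedBall 0 1) {U : Set E} (hU : IsOpen U) {f : E → F} {g : E → G}
    (hf : DifferentiableOn ℂ f U) (hfK : MapsTo f U K) (hfg : ∀ x ∈ U, f x = T (g x)) :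
    DifferentiableOn ℂ g U := by
  intro x hx
  have hlift : ∀ {r : ℝ}, 0 ≤ r → ∀ {e : G}, T e ∈ r • K → ‖e‖ ≤ r := by
    rintro r hr e ⟨k, hk, hke⟩
    obtain ⟨e', he', rfl⟩ := hKT hk
    have : e = (r : ℂ) • e' := hT (by rw [map_smul, Complex.coe_smul]; exact hke.symm)
    rw [this, norm_smul, Complex.norm_real, norm_of_nonneg hr]
    exact mul_le_of_le_one_right hr (by simpa using he')
  obtain ⟨r, hr, hrU⟩ := nhds_basis_closedBall.mem_iff.mp (hU.mem_nhds hx)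
  have hmaps : ∀ {h : E}, h ≠ 0 → ∀ w ∈ closedBall (0 : ℂ) (r / ‖h‖), x + w • h ∈ U := by
    intro h hh w hw
    apply hrU
    rw [mem_closedBall_iff_norm, add_sub_cancel_left, norm_smul]
    rw [mem_closedBall_zero_iff] at hw
    exact (le_div_iff₀ (norm_pos_iff.mpr hh)).mp hw
  have hline : ∀ {h : E}, h ≠ 0 →
      DifferentiableOn ℂ (fun w : ℂ => f (x + w • h)) (closedBall 0 (r / ‖h‖)) := fun hh =>
    hf.comp (t := U) (by fun_prop) (hmaps hh)
  have hderiv : ∀ h : E, deriv (fun w : ℂ => f (x + w • h)) 0 = fderiv ℂ f x h := by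
    intro h
    have h1 : HasFDerivAt f (fderiv ℂ f x) (x + (0 : ℂ) • h) := by
      simpa using (hf.differentiableAt (hU.mem_nhds hx)).hasFDerivAt
    have h2 : HasDerivAt (fun w : ℂ => x + w • h) h 0 := by
      simpa using ((hasDerivAt_id (0 : ℂ)).smul_const h).const_add x
    exact (h1.comp_hasDerivAt 0 h2).deriv
  have hfd : ∀ h : E, fderiv ℂ f x h ∈ (r⁻¹ * ‖h‖) • K := by
    intro h
    rcases eq_or_ne h 0 with rfl | hh
    · simpa using zero_mem_smul_set (hbal.zero_mem ⟨_, hfK hx⟩)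
    · rw [← hderiv, ← div_eq_inv_mul, ← inv_div]
      exact deriv_mem_smul hK hconv hbal (div_pos hr (norm_pos_iff.mpr hh)) (hline hh)
        fun w hw => hfK (hmaps hh w (sphere_subset_closedBall hw))
  have hex : ∀ h : E, ∃ e : G, T e = fderiv ℂ f x h := by
    intro h
    obtain ⟨k, hk, hke⟩ := hfd h
    obtain ⟨e, -, rfl⟩ := hKT hk
    exact ⟨((r⁻¹ * ‖h‖ : ℝ) : ℂ) • e, by rw [map_smul, Complex.coe_smul]; exact hke⟩
  choose D hD using hex
  let L₀ : E →ₗ[ℂ] G :=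
    { toFun := D
      map_add' := fun a b => hT (by simp [hD])
      map_smul' := fun c a => hT (by simp [hD]) }
  let L : E →L[ℂ] G := L₀.mkContinuous r⁻¹ fun h =>
    hlift (by positivity) (by simpa only [L₀, LinearMap.coe_mk, AddHom.coe_mk, hD] using hfd h)
  have hL : ∀ h, T (L h) = fderiv ℂ f x h := hD
  have hrem : ∀ h : E, ‖h‖ ≤ r / 2 → ‖g (x + h) - g x - L h‖ ≤ 2 / r ^ 2 * ‖h‖ ^ 2 := by
    intro h hh2
    rcases eq_or_ne h 0 with rfl | hh
    · simp
    have hpos := norm_pos_iff.mpr hh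
    have hρ : 2 ≤ r / ‖h‖ := by rw [le_div_iff₀ hpos]; linarith
    have h1 : x + h ∈ U := by
      simpa using hmaps hh 1 (by simp; linarith)
    refine hlift (by positivity) ?_
    have := sub_sub_deriv_mem_smul hK hconv hbal hρ (hline hh)
      fun w hw => hfK (hmaps hh w (sphere_subset_closedBall hw))
    rw [hderiv, show 2 / (r / ‖h‖) ^ 2 = 2 / r ^ 2 * ‖h‖ ^ 2 by field_simp] at this
    rw [map_sub, map_sub, hL, ← hfg _ h1, ← hfg _ hx]
    simpa using this
  refine (HasFDerivAt.differentiableAt (f' := L) ?_).differentiableWithinAt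
  rw [hasFDerivAt_iff_isLittleO_nhds_zero]
  have hO : (fun h => g (x + h) - g x - L h) =O[𝓝 0] fun h : E => ‖h‖ ^ 2 := by
    refine Asymptotics.IsBigO.of_bound (2 / r ^ 2) ?_
    filter_upwards [closedBall_mem_nhds (0 : E) (half_pos hr)] with h hh
    simpa using hrem h (by simpa using hh)
  exact hO.trans_isLittleO (Asymptotics.isLittleO_norm_pow_id one_lt_two)

/-- For every nonempty compact convex balanced set `K` there is an injective operator on a Banach
space in the lowest universe that maps the open unit ball into `K` and the closed unit ball onto a
set containing `K`. -/
theorem exists_injective_clm_image_ball {K : Set F} (hK : IsCompact K) (hconv : Convex ℝ K)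
    (hbal : Balanced ℂ K) (hne : K.Nonempty) :
    ∃ (G : Type) (_ : NormedAddCommGroup G) (_ : NormedSpace ℂ G) (_ : CompleteSpace G)
      (T : G →L[ℂ] F), Function.Injective T ∧ T '' ball 0 1 ⊆ K ∧ K ⊆ T '' closedBall 0 1 := by
  classical
  have h0 : (0 : F) ∈ K := hbal.zero_mem hne
  have : Nonempty K := hne.to_subtype
  have : CompactSpace K := isCompact_iff_compactSpace.mp hK
  obtain ⟨u, -, hu⟩ := PolishSpace.exists_nat_nat_continuous_surjective K
  set y : (ℕ → ℕ) → F := fun i => u i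
  have hy : ∀ i, y i ∈ K := fun i => (u i).2
  obtain ⟨C, hC⟩ := hK.isBounded.exists_norm_le
  have hsum : ∀ a : lp (fun _ : ℕ → ℕ => ℂ) 1, HasSum (fun i => ‖a i‖) ‖a‖ := fun a => by
    simpa using lp.hasSum_norm (p := 1) (by simp) a
  have hsummable : ∀ a : lp (fun _ : ℕ → ℕ => ℂ) 1, Summable fun i => a i • y i := fun a => by
    refine .of_norm_bounded ((hsum a).summable.mul_right C) fun i => ?_
    rw [norm_smul]
    exact mul_le_mul_of_nonneg_left (hC _ (hy i)) (norm_nonneg _)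
  let S₀ : lp (fun _ : ℕ → ℕ => ℂ) 1 →ₗ[ℂ] F :=
    { toFun := fun a => ∑' i, a i • y i
      map_add' := fun a b => by
        simp only [lp.coeFn_add, Pi.add_apply, add_smul]
        exact (hsummable a).tsum_add (hsummable b)
      map_smul' := fun c a => by
        simp only [lp.coeFn_smul, Pi.smul_apply, smul_assoc, RingHom.id_apply]
        exact (hsummable a).tsum_const_smul c }
  let S : lp (fun _ : ℕ → ℕ => ℂ) 1 →L[ℂ] F := S₀.mkContinuous C fun a => by
    refine tsum_of_norm_bounded (by simpa [mul_comm] using (hsum a).mul_right C) fun i => ?_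
    rw [norm_smul, mul_comm]
    exact mul_le_mul_of_nonneg_right (hC _ (hy i)) (norm_nonneg (a i))
  have hSK : ∀ a, ‖a‖ ≤ 1 → S a ∈ K := fun a ha => by
    refine hK.isClosed.mem_of_tendsto (hsummable a).hasSum (Eventually.of_forall fun s => ?_)
    have h1 : ∑ i ∈ s, ‖a i‖ ≤ 1 :=
      (sum_le_hasSum s (fun i _ => norm_nonneg (a i)) (hsum a)).trans ha
    obtain ⟨k, hk, hke⟩ := hbal.sum_smul_mem hconv h0 hy a s
    rw [← hke]
    exact hconv.smul_mem_of_zero_mem h0 hk ⟨Finset.sum_nonneg fun _ _ => norm_nonneg _, h1⟩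
  have hS1 : ∀ i, S (lp.single 1 i (1 : ℂ)) = y i := fun i => by
    change ∑' j, (lp.single 1 i (1 : ℂ) : lp (fun _ : ℕ → ℕ => ℂ) 1) j • y j = y i
    rw [tsum_eq_single i fun j hj => by rw [lp.single_apply_ne _ _ _ hj, zero_smul],
      lp.single_apply_self, one_smul]
  have : IsClosed (S.ker : Set (lp (fun _ : ℕ → ℕ => ℂ) 1)) := S.isClosed_ker
  refine ⟨lp (fun _ : ℕ → ℕ => ℂ) 1 ⧸ S.ker, inferInstance, inferInstance, inferInstance,
    S.ker.liftQL S le_rfl, ?_, ?_, ?_⟩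
  · rw [Submodule.coe_liftQL, ← LinearMap.ker_eq_bot]
    exact Submodule.ker_liftQ_eq_bot _ _ _ le_rfl
  · rintro _ ⟨q, hq, rfl⟩
    rw [mem_ball_zero_iff] at hq
    obtain ⟨a, rfl, ha⟩ := Submodule.Quotient.norm_mk_lt q (sub_pos.mpr hq)
    exact hSK a (by linarith)
  · intro k hk
    obtain ⟨i, hi⟩ := hu ⟨k, hk⟩
    refine ⟨Submodule.Quotient.mk (lp.single 1 i (1 : ℂ)), ?_, ?_⟩
    · rw [mem_closedBall_zero_iff]
      refine (Submodule.Quotient.norm_mk_le _ _).trans ?_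
      rw [lp.norm_single (by simp), norm_one]
    · change S _ = k
      rw [hS1]
      exact congrArg Subtype.val hi

end Factorization

/-- A bounded holomorphic mapping `f : U → F` has relatively compact range
iff it factors as `f = T ∘ g` with `T : G → F` a compact bounded linear operator and
`g : U → G` a bounded holomorphic mapping into a complex Banach space `G`. -/
theorem stmt_1 {E F : Type*} [NormedAddCommGroup E] [NormedSpace ℂ E] [CompleteSpace E]
    [NormedAddCommGroup F] [NormedSpace ℂ F] [CompleteSpace F]
    (U : Set E) (hU : IsOpen U) (hne : U.Nonempty)
    (f : E → F) (hf : DifferentiableOn ℂ f U) (hb : Bornology.IsBounded (f '' U)) :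
    IsCompact (closure (f '' U)) ↔
      ∃ (G : Type) (_ : NormedAddCommGroup G) (_ : NormedSpace ℂ G) (_ : CompleteSpace G)
        (T : G →L[ℂ] F) (g : E → G),
        IsCompactOperator T ∧
        DifferentiableOn ℂ g U ∧ Bornology.IsBounded (g '' U) ∧
        ∀ x ∈ U, f x = T (g x) := by
  constructor
  · intro hc
    obtain ⟨K, hK, hconv, hbal, hsub⟩ := hc.exists_isCompact_convex_balanced_superset
    have hfK : MapsTo f U K := mapsTo_iff_image_subset.mpr hsub
    obtain ⟨G, _, _, _, T, hT, hTK, hKT⟩ :=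
      exists_injective_clm_image_ball hK hconv hbal ((hne.image f).mono hsub)
    have hlift : ∀ x, ∃ e : G, x ∈ U → ‖e‖ ≤ 1 ∧ f x = T e := by
      intro x
      by_cases hx : x ∈ U
      · obtain ⟨e, he, hfe⟩ := hKT (hfK hx)
        exact ⟨e, fun _ => ⟨by simpa using he, hfe.symm⟩⟩
      · exact ⟨0, fun h => absurd h hx⟩
    choose g hg using hlift
    refine ⟨G, _, _, ‹_›, T, g, ?_, ?_, ?_, fun x hx => (hg x hx).2⟩
    · exact (isCompactOperator_iff_exists_mem_nhds_image_subset_compact _).mpr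
        ⟨ball 0 1, ball_mem_nhds 0 one_pos, K, hK, hTK⟩
    · exact differentiableOn_of_comp_injective hK hconv hbal hT hKT hU hf hfK
        fun x hx => (hg x hx).2
    · rw [isBounded_iff_forall_norm_le]
      exact ⟨1, by rintro _ ⟨x, hx, rfl⟩; exact (hg x hx).1⟩
  · rintro ⟨G, _, _, _, T, g, hT, -, hgb, hfg⟩
    have himage : f '' U = T '' (g '' U) := by
      rw [image_image]
      exact image_congr hfg
    rw [himage]
    exact IsCompactOperator.isCompact_closure_image_of_bounded (f := T.toLinearMap) hT hgb
end

section
/- If f : U → F is a bounded holomorphic mapping whose range f(U) is relatively compact, then there exist a complex Banach space G, a compact bounded linear operator T : G → F with operator norm ‖T‖ = ‖f‖_∞, and a holomorphic mapping g : U → G with ‖g(x)‖ = 1 for every x ∈ U, such that f(x) = T(g(x)) for all x ∈ U. -/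
open Metric Set in
/-- Cauchy estimate for the derivative of a bounded holomorphic map on a ball. -/
theorem norm_fderiv_le_of_forall_norm_le {E F : Type*} [NormedAddCommGroup E] [NormedSpace ℂ E]
    [NormedAddCommGroup F] [NormedSpace ℂ F] {u : E → F} {x : E} {r m : ℝ} (hr : 0 < r)
    (hu : DifferentiableOn ℂ u (ball x r)) (hm : ∀ z ∈ ball x r, ‖u z‖ ≤ m) :
    ‖fderiv ℂ u x‖ ≤ 2 * m / r := by
  refine Complex.norm_fderiv_le_div_of_mapsTo_ball hu (fun z hz ↦ ?_) hr
  rw [mem_closedBall_iff_norm]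
  linarith [norm_sub_le (u z) (u x), hm z hz, hm x (mem_ball_self hr)]

open Metric Set in
/-- Second order Taylor estimate for a bounded holomorphic map on a ball. -/
theorem norm_sub_sub_fderiv_le_of_forall_norm_le {E F : Type*}
    [NormedAddCommGroup E] [NormedSpace ℂ E] [NormedAddCommGroup F] [NormedSpace ℂ F]
    {u : E → F} {x z : E} {r m : ℝ} (hr : 0 < r)
    (hu : DifferentiableOn ℂ u (ball x r)) (hm : ∀ z ∈ ball x r, ‖u z‖ ≤ m)
    (hz : z ∈ ball x r) :
    ‖u z - u x - fderiv ℂ u x (z - x)‖ ≤ 4 * m * (‖z - x‖ / r) ^ 2 := by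
  have hL := norm_fderiv_le_of_forall_norm_le hr hu hm
  have hdx : DifferentiableAt ℂ u x := hu.differentiableAt (ball_mem_nhds x hr)
  set L := fderiv ℂ u x
  have hsub (w : E) : u w - L (w - x) - (u x - L (x - x)) = u w - u x - L (w - x) := by
    rw [sub_self, map_zero, sub_zero, sub_right_comm]
  have key := Complex.dist_le_mul_div_pow_of_mapsTo_ball_of_isLittleO (n := 1)
    (f := fun w ↦ u w - L (w - x)) (c := x) (R₁ := r) (R₂ := 4 * m) (z := z)
    (hu.sub (by fun_prop)) (fun w hw ↦ ?_) ?_ hz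
  · rw [dist_eq_norm, dist_eq_norm] at key
    rwa [hsub] at key
  · rw [mem_closedBall_iff_norm]
    have h1 : ‖L (w - x)‖ ≤ 2 * m := by
      have hw' : ‖w - x‖ ≤ r := (mem_ball_iff_norm.1 hw).le
      calc ‖L (w - x)‖ ≤ ‖L‖ * ‖w - x‖ := L.le_opNorm _
        _ ≤ 2 * m / r * r := by gcongr; exact (norm_nonneg _).trans hL
        _ = 2 * m := by field_simp
    have h2 := norm_sub_le (u w - u x) (L (w - x))
    have h3 := norm_sub_le (u w) (u x)
    rw [hsub]
    linarith [hm w hw, hm x (mem_ball_self hr)]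
  · simp only [pow_one]
    refine (hdx.hasFDerivAt.isLittleO.norm_right).congr_left fun w ↦ (hsub w).symm

open Metric Set in
/-- A lift of a holomorphic map `f : U → F` through an injective operator `S` is holomorphic as
soon as every point of `F` in the weak gauge of `f '' U` lifts with control of the norm. -/
theorem differentiableOn_of_injective_comp {E F H : Type*}
    [NormedAddCommGroup E] [NormedSpace ℂ E] [NormedAddCommGroup F] [NormedSpace ℂ F]
    [NormedAddCommGroup H] [NormedSpace ℂ H] {U : Set E} (hU : IsOpen U) {f : E → F}
    (hf : DifferentiableOn ℂ f U) (S : H →L[ℂ] F) (hS : Function.Injective S)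
    (hlift : ∀ (y : F) (C : ℝ), 0 ≤ C →
      (∀ (φ : StrongDual ℂ F) (m : ℝ), (∀ z ∈ f '' U, ‖φ z‖ ≤ m) → ‖φ y‖ ≤ C * m) →
      ∃ w : H, S w = y ∧ ‖w‖ ≤ C)
    {h : E → H} (hh : ∀ x ∈ U, S (h x) = f x) : DifferentiableOn ℂ h U := by
  intro x hx
  obtain ⟨r, hr, hrU⟩ := Metric.isOpen_iff.1 hU x hx
  have hfx : DifferentiableAt ℂ f x := hf.differentiableAt (hU.mem_nhds hx)
  have hcomp (φ : StrongDual ℂ F) : DifferentiableOn ℂ (fun z ↦ φ (f z)) (ball x r) :=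
    φ.differentiable.comp_differentiableOn (hf.mono hrU)
  have hbd (φ : StrongDual ℂ F) (m : ℝ) (hm : ∀ z ∈ f '' U, ‖φ z‖ ≤ m) :
      ∀ z ∈ ball x r, ‖φ (f z)‖ ≤ m := fun z hz ↦ hm _ (mem_image_of_mem f (hrU hz))
  have hder (φ : StrongDual ℂ F) (v : E) :
      fderiv ℂ (fun z ↦ φ (f z)) x v = φ (fderiv ℂ f x v) := by
    have : HasFDerivAt (fun z ↦ φ (f z)) (φ ∘L fderiv ℂ f x) x :=
      φ.hasFDerivAt.comp x hfx.hasFDerivAt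
    rw [this.fderiv]
    rfl
  have hD (v : E) : ∃ w : H, S w = fderiv ℂ f x v ∧ ‖w‖ ≤ 2 / r * ‖v‖ := by
    refine hlift _ _ (by positivity) fun φ m hm ↦ ?_
    rw [← hder]
    calc _ ≤ ‖fderiv ℂ (fun z ↦ φ (f z)) x‖ * ‖v‖ := ContinuousLinearMap.le_opNorm _ _
      _ ≤ 2 * m / r * ‖v‖ := by
        gcongr
        exact norm_fderiv_le_of_forall_norm_le hr (hcomp φ) (hbd φ m hm)
      _ = 2 / r * ‖v‖ * m := by ring
  choose D hSD hDn using hD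
  let D' : E →L[ℂ] H := LinearMap.mkContinuous
    { toFun := D
      map_add' := fun v w ↦ hS (by simp [hSD])
      map_smul' := fun c v ↦ hS (by simp [hSD]) } (2 / r) hDn
  have hD' : HasFDerivAt h D' x := by
    refine .of_isLittleO (Asymptotics.IsBigO.trans_isLittleO
      (g := fun z ↦ ‖z - x‖ ^ 2) (.of_bound (4 / r ^ 2) ?_) ?_)
    · filter_upwards [ball_mem_nhds x hr] with z hz
      obtain ⟨w, hw, hwn⟩ := hlift (f z - f x - fderiv ℂ f x (z - x))
          (4 / r ^ 2 * ‖z - x‖ ^ 2) (by positivity) fun φ m hm ↦ by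
        rw [map_sub, map_sub, ← hder]
        refine (norm_sub_sub_fderiv_le_of_forall_norm_le hr (hcomp φ) (hbd φ m hm) hz).trans_eq ?_
        ring
      have hwz : h z - h x - D' (z - x) = w := hS (by
        rw [map_sub, map_sub, hh z (hrU hz), hh x hx, hw]
        exact congrArg _ (hSD (z - x)))
      rw [hwz]
      simpa using hwn
    · refine Asymptotics.IsLittleO.of_norm_right ?_
      have h0 : Filter.Tendsto (fun z : E ↦ ‖z - x‖) (nhds x) (nhds 0) := by
        simpa using (by fun_prop : Continuous fun z : E ↦ ‖z - x‖).tendsto x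
      exact (Asymptotics.isLittleO_pow_id (𝕜 := ℝ) one_lt_two).comp_tendsto h0
  exact hD'.differentiableAt.differentiableWithinAt

/-- An operator is compact if the dual seminorm `φ ↦ sup_{z ∈ s} ‖φ z‖` of a relatively compact set
`s` dominates the image of its unit ball. -/
theorem isCompactOperator_of_forall_dual_norm_le {F H : Type*} [NormedAddCommGroup F]
    [NormedSpace ℂ F] [CompleteSpace F] [NormedAddCommGroup H] [NormedSpace ℂ H]
    {s : Set F} (hs : IsCompact (closure s)) (S : H →L[ℂ] F)
    (hS : ∀ (w : H) (φ : StrongDual ℂ F) (m : ℝ), (∀ z ∈ s, ‖φ z‖ ≤ m) → ‖φ (S w)‖ ≤ ‖w‖ * m) :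
    IsCompactOperator S := by
  rcases s.eq_empty_or_nonempty with rfl | hne
  · have : (S : H → F) = 0 := by
      funext w
      refine SeparatingDual.eq_zero_of_forall_dual_eq_zero (R := ℂ) fun φ ↦ ?_
      simpa using hS w φ 0 (by simp)
    rw [this]
    exact isCompactOperator_zero
  let B : Set F := (fun p : ℂ × F ↦ p.1 • p.2) '' (Metric.closedBall 0 1 ×ˢ closure s)
  have hB : IsCompact B := ((isCompact_closedBall _ _).prod hs).image continuous_smul
  have hK := isCompact_closedAbsConvexHull_of_totallyBounded hB.totallyBounded
  refine (isCompactOperator_iff_image_closedBall_subset_compact (S : H →ₗ[ℂ] F) one_pos).2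
    ⟨_, hK, ?_⟩
  rintro _ ⟨w, hw, rfl⟩
  rw [mem_closedBall_zero_iff] at hw
  by_contra hmem
  obtain ⟨φ, u, hφu, hu⟩ := RCLike.geometric_hahn_banach_closed_point (𝕜 := ℂ)
    absConvex_convexClosedHull.2 isClosed_closedAbsConvexHull hmem
  have hsu : ∀ z ∈ s, ‖φ z‖ ≤ u := fun z hz ↦ by
    obtain ⟨c, hc, hcz⟩ := RCLike.exists_norm_eq_mul_self (φ z)
    have := hφu (c • z) (subset_closedAbsConvexHull
      ⟨(c, z), ⟨by simp [hc], subset_closure hz⟩, rfl⟩)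
    rw [map_smul, smul_eq_mul, ← hcz] at this
    simpa using this.le
  obtain ⟨z, hz⟩ := hne
  have hu0 : 0 ≤ u := (norm_nonneg _).trans (hsu z hz)
  have h1 := hS w φ u hsu
  have h2 : RCLike.re (φ (S w)) ≤ ‖φ (S w)‖ := RCLike.re_le_norm _
  have h3 : ‖w‖ * u ≤ u := mul_le_of_le_one_left hu0 hw
  exact (hu.trans_le (h2.trans (h1.trans h3))).false

/-- The pullback of a bounded operator `T : V → W` along an isometric embedding `ι : F → W`. -/
theorem exists_pullback_linearIsometry {F : Type*} {V : Type} {W : Type*}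
    [NormedAddCommGroup F] [NormedSpace ℂ F] [CompleteSpace F]
    [NormedAddCommGroup V] [NormedSpace ℂ V] [CompleteSpace V]
    [NormedAddCommGroup W] [NormedSpace ℂ W] (ι : F →ₗᵢ[ℂ] W) (T : V →L[ℂ] W) :
    ∃ (H : Type) (_ : NormedAddCommGroup H) (_ : NormedSpace ℂ H) (_ : CompleteSpace H)
      (j : H →ₗᵢ[ℂ] V) (S : H →L[ℂ] F), (∀ w, ι (S w) = T (j w)) ∧
      ∀ (v : V) (x : F), T v = ι x → ∃ w, j w = v ∧ S w = x := by
  let R := LinearMap.range ι.toLinearMap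
  let H : Submodule ℂ V := R.comap (T : V →ₗ[ℂ] W)
  have hR : IsClosed (R : Set W) := by
    have : (R : Set W) = Set.range ι := LinearMap.coe_range _
    rw [this]
    exact ι.isometry.isClosedEmbedding.isClosed_range
  have hH : IsClosed (H : Set V) := hR.preimage T.continuous
  let S : H →L[ℂ] F := (ι.equivRange.symm : R →L[ℂ] F) ∘L
    ((T ∘L H.subtypeL).codRestrict R fun w ↦ w.2)
  have hS (w : H) : ι (S w) = T w :=
    congrArg Subtype.val (ι.equivRange.apply_symm_apply ⟨T w, w.2⟩)
  exact ⟨H, inferInstance, inferInstance, hH.completeSpace_coe, H.subtypeₗᵢ, S, hS,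
    fun v x h ↦ ⟨⟨v, x, h.symm⟩, rfl, ι.injective ((hS _).trans h)⟩⟩

/-- The Banach space of all points of finite gauge with respect to the closed absolutely convex hull
of a relatively compact set `s`, realised as a small type, with its inclusion operator. -/
theorem exists_gauge_space {F : Type*} [NormedAddCommGroup F] [NormedSpace ℂ F] [CompleteSpace F]
    {s : Set F} (hne : s.Nonempty) (hs : IsCompact (closure s)) :
    ∃ (H : Type) (_ : NormedAddCommGroup H) (_ : NormedSpace ℂ H) (_ : CompleteSpace H)
      (S : H →L[ℂ] F), Function.Injective S ∧
      (∀ (w : H) (φ : StrongDual ℂ F) (m : ℝ), (∀ z ∈ s, ‖φ z‖ ≤ m) → ‖φ (S w)‖ ≤ ‖w‖ * m) ∧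
      ∀ (y : F) (C : ℝ), 0 ≤ C →
        (∀ (φ : StrongDual ℂ F) (m : ℝ), (∀ z ∈ s, ‖φ z‖ ≤ m) → ‖φ y‖ ≤ C * m) →
        ∃ w : H, S w = y ∧ ‖w‖ ≤ C := by
  obtain ⟨y, hys, hy⟩ : ∃ y : ℕ → F, (∀ n, y n ∈ s) ∧ s ⊆ closure (Set.range y) := by
    obtain ⟨t, hts, htc, hst⟩ := (hs.isSeparable.mono subset_closure).exists_countable_dense_subset
    have htn : t.Nonempty := closure_nonempty_iff.1 (hne.mono hst)
    obtain ⟨y, rfl⟩ := htc.exists_eq_range htn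
    exact ⟨y, fun n ↦ hts ⟨n, rfl⟩, hst⟩
  obtain ⟨M, hM⟩ := (hs.isBounded.subset subset_closure).exists_norm_le
  have hM0 : 0 ≤ M := (norm_nonneg _).trans (hM _ (hys 0))
  have hle (φ : StrongDual ℂ F) (n : ℕ) : ‖φ (y n)‖ ≤ M * ‖φ‖ := by
    rw [mul_comm]
    exact φ.le_opNorm_of_le (hM _ (hys n))
  let J : StrongDual ℂ F →L[ℂ] BoundedContinuousFunction ℕ ℂ := LinearMap.mkContinuous
    { toFun := fun φ ↦ BoundedContinuousFunction.ofNormedAddCommGroupDiscrete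
        (fun n ↦ φ (y n)) (M * ‖φ‖) (hle φ)
      map_add' := fun φ ψ ↦ by ext; rfl
      map_smul' := fun c φ ↦ by ext; rfl } M
    (fun φ ↦ (BoundedContinuousFunction.norm_le (by positivity)).2 (hle φ))
  have hJ (φ : StrongDual ℂ F) (n : ℕ) : J φ n = φ (y n) := rfl
  have hJle (φ : StrongDual ℂ F) (m : ℝ) (hm : ∀ z ∈ s, ‖φ z‖ ≤ m) : ‖J φ‖ ≤ m :=
    (BoundedContinuousFunction.norm_le ((norm_nonneg _).trans (hm _ (hys 0)))).2
      fun n ↦ hm _ (hys n)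
  have hleJ (φ : StrongDual ℂ F) : ∀ z ∈ s, ‖φ z‖ ≤ ‖J φ‖ := fun z hz ↦ by
    refine closure_minimal (s := Set.range y) (t := {z | ‖φ z‖ ≤ ‖J φ‖}) ?_
      (isClosed_le (by fun_prop) continuous_const) (hy hz)
    rintro _ ⟨n, rfl⟩
    exact (J φ).norm_coe_le_norm n
  let A := LinearMap.range (J : StrongDual ℂ F →ₗ[ℂ] BoundedContinuousFunction ℕ ℂ)
  let J' : StrongDual ℂ F →L[ℂ] A := J.codRestrict A fun φ ↦ ⟨φ, rfl⟩
  have hJ' : Function.Surjective J' := by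
    rintro ⟨_, φ, rfl⟩
    exact ⟨φ, rfl⟩
  let ι := NormedSpace.inclusionInDoubleDualLi ℂ (E := F)
  let Jt : StrongDual ℂ A →L[ℂ] StrongDual ℂ (StrongDual ℂ F) :=
    (ContinuousLinearMap.compL ℂ (StrongDual ℂ F) A ℂ).flip J'
  have hJt (ℓ : StrongDual ℂ A) (φ : StrongDual ℂ F) : Jt ℓ φ = ℓ (J' φ) := rfl
  obtain ⟨H, _, _, _, j, S, hjS, hH⟩ := exists_pullback_linearIsometry
    (V := StrongDual ℂ A) (W := StrongDual ℂ (StrongDual ℂ F)) ι Jt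
  have hS (w : H) (φ : StrongDual ℂ F) : φ (S w) = j w (J' φ) := by
    rw [← hJt, ← hjS]
    rfl
  refine ⟨H, inferInstance, inferInstance, inferInstance, S, ?_, ?_, ?_⟩
  · intro w w' hw
    refine j.injective (ContinuousLinearMap.ext fun a ↦ ?_)
    obtain ⟨φ, rfl⟩ := hJ' a
    rw [← hS, ← hS, hw]
  · intro w φ m hm
    rw [hS, ← j.norm_map]
    exact (j w).le_opNorm_of_le (hJle φ m hm)
  · intro x C hC hx
    choose σ hσ using hJ'
    have hx' (φ : StrongDual ℂ F) : ‖φ x‖ ≤ C * ‖J φ‖ := hx φ _ (hleJ φ)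
    have huniq (φ ψ : StrongDual ℂ F) (h : J' φ = J' ψ) : φ x = ψ x := by
      have h0 : J (φ - ψ) = 0 := by
        rw [map_sub, sub_eq_zero]
        exact congrArg Subtype.val h
      have := hx' (φ - ψ)
      rw [h0, norm_zero, mul_zero, norm_le_zero_iff] at this
      exact sub_eq_zero.1 this
    let ℓ : StrongDual ℂ A := LinearMap.mkContinuous
      { toFun := fun a ↦ σ a x
        map_add' := fun a b ↦ huniq (σ (a + b)) (σ a + σ b) (by simp [hσ])
        map_smul' := fun c a ↦ huniq (σ (c • a)) (c • σ a) (by simp [hσ]) } C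
      (fun a ↦ by
        have := hx' (σ a)
        have h2 : J (σ a) = (a : BoundedContinuousFunction ℕ ℂ) := congrArg Subtype.val (hσ a)
        rwa [h2] at this)
    have hℓ (φ : StrongDual ℂ F) : ℓ (J' φ) = φ x := huniq _ _ (hσ _)
    obtain ⟨w, hw, hwx⟩ := hH ℓ x (ContinuousLinearMap.ext hℓ)
    refine ⟨w, hwx, ?_⟩
    rw [← j.norm_map, hw]
    exact LinearMap.mkContinuous_norm_le _ hC _

/-- If `f : U → F` is bounded holomorphic with relatively compact range, then
there exist a complex Banach space `G`, a compact bounded linear operator `T : G → F` with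
`‖T‖ = ‖f‖_∞`, and a holomorphic mapping `g : U → G` with `‖g x‖ = 1` for all `x ∈ U`, such
that `f = T ∘ g` on `U`. -/
theorem stmt_6 {E F : Type*} [NormedAddCommGroup E] [NormedSpace ℂ E] [CompleteSpace E]
    [NormedAddCommGroup F] [NormedSpace ℂ F] [CompleteSpace F]
    (U : Set E) (hU : IsOpen U) (hne : U.Nonempty)
    (f : E → F) (hf : DifferentiableOn ℂ f U) (hb : Bornology.IsBounded (f '' U))
    (hc : IsCompact (closure (f '' U))) :
    ∃ (G : Type) (_ : NormedAddCommGroup G) (_ : NormedSpace ℂ G) (_ : CompleteSpace G)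
      (T : G →L[ℂ] F) (g : E → G),
      IsCompactOperator T ∧
      ‖T‖ = ⨆ x : U, ‖f (x : E)‖ ∧
      DifferentiableOn ℂ g U ∧
      (∀ x ∈ U, ‖g x‖ = 1) ∧
      ∀ x ∈ U, f x = T (g x) := by
  have hne' : (f '' U).Nonempty := hne.image f
  obtain ⟨H, _, _, _, S, hSinj, hSle, hlift⟩ := exists_gauge_space hne' hc
  have hbdd : BddAbove (Set.range fun x : U ↦ ‖f (x : E)‖) := by
    obtain ⟨C, hC⟩ := hb.exists_norm_le
    exact ⟨C, by rintro _ ⟨x, rfl⟩; exact hC _ ⟨x, x.2, rfl⟩⟩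
  set M := ⨆ x : U, ‖f (x : E)‖
  have hfM (x : E) (hx : x ∈ U) : ‖f x‖ ≤ M := le_ciSup hbdd ⟨x, hx⟩
  have hM0 : 0 ≤ M := Real.iSup_nonneg fun _ ↦ norm_nonneg _
  have hSM : ‖S‖ ≤ M := S.opNorm_le_bound hM0 fun w ↦ by
    refine NormedSpace.norm_le_dual_bound ℂ _ (by positivity) fun φ ↦ ?_
    refine (hSle w φ (‖φ‖ * M) ?_).trans_eq (by ring)
    rintro _ ⟨x, hx, rfl⟩
    exact φ.le_opNorm_of_le (hfM x hx)
  have hex (x : E) : ∃ w : H, x ∈ U → S w = f x ∧ ‖w‖ ≤ 1 := by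
    by_cases hx : x ∈ U
    · obtain ⟨w, hw⟩ := hlift (f x) 1 zero_le_one fun φ m hm ↦ by
        simpa using hm _ ⟨x, hx, rfl⟩
      exact ⟨w, fun _ ↦ hw⟩
    · exact ⟨0, fun h ↦ absurd h hx⟩
  choose h hh using hex
  have hg1 (x : E) (hx : x ∈ U) : ‖((1 : ℂ), h x)‖ = 1 := by
    simp [Prod.norm_def, (hh x hx).2]
  refine ⟨ℂ × H, inferInstance, inferInstance, inferInstance,
    S ∘L ContinuousLinearMap.snd ℂ ℂ H, fun x ↦ (1, h x), ?_, ?_, ?_, hg1, ?_⟩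
  · exact (isCompactOperator_of_forall_dual_norm_le hc S hSle).comp_clm _
  · apply le_antisymm
    · calc _ ≤ ‖S‖ * ‖ContinuousLinearMap.snd ℂ ℂ H‖ := ContinuousLinearMap.opNorm_comp_le _ _
        _ ≤ M * 1 := by
          gcongr
          exact ContinuousLinearMap.norm_snd_le ℂ ℂ H
        _ = M := mul_one M
    · have : Nonempty U := hne.to_subtype
      refine ciSup_le fun x ↦ ?_
      have := (S ∘L ContinuousLinearMap.snd ℂ ℂ H).le_opNorm (1, h x)
      rw [hg1 x x.2, mul_one] at this
      simpa [(hh x x.2).1] using this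
  · exact (differentiableOn_const _).prodMk
      (differentiableOn_of_injective_comp hU hf S hSinj hlift fun x hx ↦ (hh x hx).1)
  · intro x hx
    simp [(hh x hx).1]
end

section
/- A bounded holomorphic mapping f : U → F has relatively compact range f(U) if and only if its transpose f^t : F* → H^∞(U), f^t(y*) = y* ∘ f, is a compact bounded linear operator. -/
theorem totallyBounded_range_iff_finite_net {X M : Type*} [PseudoMetricSpace M] (h : X → M) :
    TotallyBounded (Set.range h) ↔
      ∀ ε > 0, ∃ t : Set X, t.Finite ∧ ∀ x, ∃ x' ∈ t, dist (h x) (h x') < ε := by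
  constructor
  · intro H ε hε
    obtain ⟨s, hs, hsfin, hcov⟩ := Metric.finite_approx_of_totallyBounded H ε hε
    rw [← Set.image_univ] at hs
    obtain ⟨t, -, ht⟩ := Set.SurjOn.exists_bijOn_subset hs
    refine ⟨t, ht.finite_iff_finite.2 hsfin, fun x => ?_⟩
    rw [← ht.image_eq] at hcov
    simpa using hcov (Set.mem_range_self x)
  · intro H
    refine Metric.totallyBounded_iff.2 fun ε hε => ?_
    obtain ⟨t, ht, hnet⟩ := H ε hε
    refine ⟨h '' t, ht.image h, ?_⟩
    rintro _ ⟨x, rfl⟩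
    simpa using hnet x

/-- If a bounded kernel has finite uniform nets in its first variable, then it also has
finite uniform nets in its second variable. -/
theorem exists_finite_net_swap {X Y M : Type*} [PseudoMetricSpace M] [ProperSpace M]
    (g : X → Y → M) (hg : Bornology.IsBounded (Set.range (Function.uncurry g)))
    (H : ∀ ε > 0, ∃ t : Set X, t.Finite ∧ ∀ x, ∃ x' ∈ t, ∀ y, dist (g x y) (g x' y) ≤ ε) :
    ∀ ε > 0, ∃ t : Set Y, t.Finite ∧ ∀ y, ∃ y' ∈ t, ∀ x, dist (g x y) (g x y') ≤ ε := by
  intro ε hε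
  obtain ⟨t, ht, hnet⟩ := H (ε / 3) (by positivity)
  have := ht.fintype
  have hbdd : Bornology.IsBounded (Set.range fun (y : Y) (x : t) => g x y) := by
    refine (Bornology.IsBounded.pi fun _ : t => hg).subset ?_
    rintro _ ⟨y, rfl⟩ x -
    exact ⟨(x, y), rfl⟩
  obtain ⟨s, hs, hsnet⟩ := (totallyBounded_range_iff_finite_net _).1
    ((Bornology.IsBounded.isCompact_closure hbdd).totallyBounded.subset subset_closure)
    (ε / 3) (by positivity)
  refine ⟨s, hs, fun y => ?_⟩
  obtain ⟨y', hy', hyy'⟩ := hsnet y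
  refine ⟨y', hy', fun x => ?_⟩
  obtain ⟨x', hx', hxx'⟩ := hnet x
  have h₁ := hxx' y
  have h₂ := hxx' y'
  rw [dist_comm] at h₂
  have h₃ : dist (g x' y) (g x' y') ≤ ε / 3 :=
    (dist_le_pi_dist (fun x : t => g x y) (fun x : t => g x y') ⟨x', hx'⟩).trans hyy'.le
  linarith [dist_triangle4 (g x y) (g x' y) (g x' y') (g x y')]

theorem isCompact_closure_range_iff_finite_net {X M : Type*} [PseudoMetricSpace M]
    [CompleteSpace M] (h : X → M) :
    IsCompact (closure (Set.range h)) ↔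
      ∀ ε > 0, ∃ t : Set X, t.Finite ∧ ∀ x, ∃ x' ∈ t, dist (h x) (h x') ≤ ε := by
  have hcl : IsCompact (closure (Set.range h)) ↔ TotallyBounded (Set.range h) :=
    ⟨fun H => H.totallyBounded.subset subset_closure,
      fun H => H.closure.isCompact_of_isClosed isClosed_closure⟩
  rw [hcl, totallyBounded_range_iff_finite_net]
  constructor
  · intro H ε hε
    obtain ⟨t, ht, hnet⟩ := H ε hε
    exact ⟨t, ht, fun x => (hnet x).imp fun _ h => ⟨h.1, h.2.le⟩⟩
  · intro H ε hε
    obtain ⟨t, ht, hnet⟩ := H (ε / 2) (by positivity)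
    exact ⟨t, ht, fun x => (hnet x).imp fun _ h => ⟨h.1, h.2.trans_lt (by linarith)⟩⟩

theorem dist_le_iff_forall_dual_closedBall {𝕜 F : Type*} [RCLike 𝕜] [NormedAddCommGroup F]
    [NormedSpace 𝕜 F] (a b : F) {ε : ℝ} :
    dist a b ≤ ε ↔ ∀ φ : Metric.closedBall (0 : F →L[𝕜] 𝕜) 1, dist (φ.1 a) (φ.1 b) ≤ ε := by
  simp only [dist_eq_norm, ← map_sub]
  constructor
  · rintro H ⟨φ, hφ⟩
    rw [mem_closedBall_zero_iff] at hφ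
    exact (φ.le_of_opNorm_le hφ _).trans (by simpa using H)
  · intro H
    obtain ⟨φ, hφ, hφab⟩ := exists_dual_vector'' 𝕜 (a - b)
    simpa [hφab] using H ⟨φ, mem_closedBall_zero_iff.2 hφ⟩

/-- A bounded holomorphic mapping `f : U → F` has relatively compact range
iff its transpose `f^t : F* → H^∞(U)`, `f^t(y*) = y* ∘ f`, is a compact bounded linear
operator. (We realize `H^∞(U)` inside the bounded continuous functions on `U` with the sup
norm; the transpose is the continuous linear operator `T` determined by
`T φ x = φ (f x)` for `φ ∈ F*` and `x ∈ U`.) -/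
theorem stmt_16 {E F : Type*} [NormedAddCommGroup E] [NormedSpace ℂ E] [CompleteSpace E]
    [NormedAddCommGroup F] [NormedSpace ℂ F] [CompleteSpace F]
    (U : Set E) (hU : IsOpen U) (hne : U.Nonempty)
    (f : E → F) (hf : DifferentiableOn ℂ f U) (hb : Bornology.IsBounded (f '' U))
    (T : (F →L[ℂ] ℂ) →L[ℂ] BoundedContinuousFunction U ℂ)
    (hT : ∀ (φ : F →L[ℂ] ℂ) (x : U), T φ x = φ (f x)) :
    IsCompact (closure (f '' U)) ↔ IsCompactOperator T := by
  let B := Metric.closedBall (0 : F →L[ℂ] ℂ) 1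
  let g : U → B → ℂ := fun x φ => φ.1 (f x)
  have hg : Bornology.IsBounded (Set.range (Function.uncurry g)) := by
    obtain ⟨C, hC⟩ := hb.exists_norm_le
    refine isBounded_iff_forall_norm_le.2 ⟨C, ?_⟩
    rintro _ ⟨⟨x, φ, hφ⟩, rfl⟩
    rw [mem_closedBall_zero_iff] at hφ
    simpa [g] using φ.le_of_opNorm_le_of_le hφ (hC _ ⟨x, x.2, rfl⟩)
  have hg' : Bornology.IsBounded (Set.range (Function.uncurry fun φ x => g x φ)) := by
    refine hg.subset ?_
    rintro _ ⟨⟨φ, x⟩, rfl⟩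
    exact ⟨(x, φ), rfl⟩
  have hrange : IsCompact (closure (f '' U)) ↔ ∀ ε > 0, ∃ t : Set U, t.Finite ∧
      ∀ x, ∃ x' ∈ t, ∀ φ, dist (g x φ) (g x' φ) ≤ ε := by
    rw [Set.image_eq_range, isCompact_closure_range_iff_finite_net]
    refine forall₂_congr fun ε hε => ?_
    simp only [dist_le_iff_forall_dual_closedBall (𝕜 := ℂ) (F := F), g, B]
  have hop : IsCompactOperator T ↔ ∀ ε > 0, ∃ s : Set B, s.Finite ∧
      ∀ φ, ∃ φ' ∈ s, ∀ x, dist (g x φ) (g x φ') ≤ ε := by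
    have hball := isCompactOperator_iff_isCompact_closure_image_closedBall
      (T : (F →L[ℂ] ℂ) →ₗ[ℂ] BoundedContinuousFunction U ℂ) one_pos
    rw [Set.image_eq_range, isCompact_closure_range_iff_finite_net] at hball
    refine hball.trans (forall₂_congr fun ε hε => ?_)
    have hdist (φ φ' : B) : dist (T φ) (T φ') ≤ ε ↔ ∀ x, dist (g x φ) (g x φ') ≤ ε := by
      rw [BoundedContinuousFunction.dist_le (le_of_lt hε)]
      simp only [hT, g]
    simp only [← hdist]
    rfl
  rw [hrange, hop]
  exact ⟨exists_finite_net_swap g hg, exists_finite_net_swap (fun φ x => g x φ) hg'⟩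
end

section
/- A bounded holomorphic mapping f : U → F has relatively weakly compact range f(U) if and only if its transpose f^t : F* → H^∞(U), f^t(y*) = y* ∘ f, is a weakly compact bounded linear operator. -/
/-- A subset `s` of a complex normed space is relatively weakly compact if its closure in
the weak topology is (weakly) compact. -/
def RelWeaklyCompact {F : Type*} [NormedAddCommGroup F] [NormedSpace ℂ F] (s : Set F) : Prop :=
  IsCompact (closure ((toWeakSpace ℂ F) '' s))

/-- A bounded linear operator between complex normed spaces is weakly compact if the image of
the closed unit ball is relatively weakly compact. -/
def WeaklyCompactOperator {G F : Type*} [NormedAddCommGroup G] [NormedSpace ℂ G]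
    [NormedAddCommGroup F] [NormedSpace ℂ F] (T : G →L[ℂ] F) : Prop :=
  RelWeaklyCompact (T '' Metric.closedBall 0 1)


theorem continuous_strongDual_toWeakSpace_symm {F : Type*} [NormedAddCommGroup F]
    [NormedSpace ℂ F] (φ : StrongDual ℂ F) :
    Continuous fun x : WeakSpace ℂ F => φ ((toWeakSpace ℂ F).symm x) :=
  WeakBilin.eval_continuous (topDualPairing ℂ F).flip φ

theorem weaklyCompactOperator_of_forall_exists_eval {F G : Type*} [NormedAddCommGroup F]
    [NormedSpace ℂ F] [NormedAddCommGroup G] [NormedSpace ℂ G] (S : StrongDual ℂ F →L[ℂ] G)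
    (hS : ∀ γ : StrongDual ℂ G, ∃ x : F, ∀ φ, γ (S φ) = φ x) : WeaklyCompactOperator S := by
  let R : WeakDual ℂ F → WeakSpace ℂ G := fun φ => toWeakSpace ℂ G (S φ.toStrongDual)
  have hR : Continuous R := by
    refine WeakBilin.continuous_of_continuous_eval _ fun γ => ?_
    obtain ⟨x, hx⟩ := hS γ
    exact (WeakDual.eval_continuous x).congr fun φ => (hx φ.toStrongDual).symm
  refine ((WeakDual.isCompact_closedBall (0 : StrongDual ℂ F) 1).image hR).closure_of_subset ?_
  rintro _ ⟨_, ⟨φ, hφ, rfl⟩, rfl⟩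
  exact ⟨φ.toWeakDual, hφ, rfl⟩

theorem WeaklyCompactOperator.exists_forall_apply_comp_eq_of_norm_le_one {H G : Type*}
    [NormedAddCommGroup H] [NormedSpace ℂ H] [NormedAddCommGroup G] [NormedSpace ℂ G] {S : H →L[ℂ] G}
    (hS : WeaklyCompactOperator S) (Φ : StrongDual ℂ (StrongDual ℂ H)) (hΦ : ‖Φ‖ ≤ 1) :
    ∃ g : G, ∀ γ : StrongDual ℂ G, Φ (γ.comp S) = γ g := by
  let C := closure (toWeakSpace ℂ G '' (S '' Metric.closedBall 0 1))
  let Z : StrongDual ℂ G → Set (WeakSpace ℂ G) := fun γ =>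
    {x | γ ((toWeakSpace ℂ G).symm x) = Φ (γ.comp S)}
  suffices h : (C ∩ ⋂ γ, Z γ).Nonempty by
    obtain ⟨x, -, hx⟩ := h
    exact ⟨(toWeakSpace ℂ G).symm x, fun γ => (Set.mem_iInter.1 hx γ).symm⟩
  refine IsCompact.inter_iInter_nonempty hS Z (fun γ => isClosed_eq
    (continuous_strongDual_toWeakSpace_symm γ) continuous_const) fun t => ?_
  let L : G →ₗ[ℂ] t → ℂ := LinearMap.pi fun γ => (γ : StrongDual ℂ G).toLinearMap
  let K : Set (t → ℂ) := (fun x : WeakSpace ℂ G => L ((toWeakSpace ℂ G).symm x)) '' C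
  let v : t → ℂ := fun γ => Φ ((γ : StrongDual ℂ G).comp S)
  have hKconv : Convex ℝ K := by
    have h1 : Convex ℝ (S '' Metric.closedBall 0 1) :=
      (convex_closedBall _ _).is_linear_image (S.restrictScalars ℝ).toLinearMap.isLinear
    have h2 : K = L '' closure (S '' Metric.closedBall 0 1) := by
      rw [show K = _ '' _ from rfl, show C = _ from (h1.toWeakSpace_closure ℂ).symm,
        Set.image_image]
      simp
    rw [h2]
    exact h1.closure.is_linear_image (L.restrictScalars ℝ).isLinear
  have hKclosed : IsClosed K := (IsCompact.image hS <| continuous_pi fun γ : t =>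
    continuous_strongDual_toWeakSpace_symm (γ : StrongDual ℂ G)).isClosed
  suffices hv : v ∈ K by
    obtain ⟨x, hx, hxv⟩ := hv
    exact ⟨x, hx, Set.mem_iInter₂.2 fun γ hγ => congr_fun hxv ⟨γ, hγ⟩⟩
  by_contra hv
  obtain ⟨u, s, hu, hs⟩ := RCLike.geometric_hahn_banach_closed_point (𝕜 := ℂ) hKconv hKclosed hv
  classical
  let γ : StrongDual ℂ G := ∑ i : t, u (Pi.single i 1) • (i : StrongDual ℂ G)
  have hu_eq (z : t → ℂ) : u z = ∑ i, u (Pi.single i 1) * z i := by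
    conv_lhs => rw [pi_eq_sum_univ' z]
    simp [mul_comm]
  have huL (x : G) : u (L x) = γ x := by
    rw [hu_eq]
    simp [γ, L]
  have huv : u v = Φ (γ.comp S) := by
    rw [hu_eq, show γ.comp S = ∑ i : t, u (Pi.single i 1) • (i : StrongDual ℂ G).comp S by
      ext x; simp [γ], map_sum]
    simp [v]
  have hre (x : H) (hx : ‖x‖ ≤ 1) : (γ (S x)).re < s := by
    rw [← huL]
    exact hu _ ⟨toWeakSpace ℂ G (S x),
      subset_closure ⟨_, ⟨x, by simpa using hx, rfl⟩, rfl⟩, rfl⟩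
  have hs0 : 0 < s := by simpa using hre 0 (by simp)
  have hnorm : ‖γ.comp S‖ ≤ s := by
    refine ContinuousLinearMap.opNorm_le_of_unit_norm hs0.le fun x hx => ?_
    obtain ⟨c, hc, hcx⟩ := Complex.exists_norm_eq_mul_self (γ (S x))
    have := hre (c • x) (by rw [norm_smul, hc, hx, one_mul])
    rw [map_smul, map_smul, smul_eq_mul, ← hcx, Complex.ofReal_re] at this
    exact this.le
  have : (u v).re ≤ s := by
    rw [huv]
    calc _ ≤ ‖Φ (γ.comp S)‖ := Complex.re_le_norm _
      _ ≤ 1 * ‖γ.comp S‖ := Φ.le_of_opNorm_le hΦ _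
      _ ≤ s := by simpa using hnorm
  exact this.not_gt hs

theorem WeaklyCompactOperator.exists_forall_apply_comp_eq {H G : Type*} [NormedAddCommGroup H]
    [NormedSpace ℂ H] [NormedAddCommGroup G] [NormedSpace ℂ G] {S : H →L[ℂ] G}
    (hS : WeaklyCompactOperator S) (Φ : StrongDual ℂ (StrongDual ℂ H)) :
    ∃ g : G, ∀ γ : StrongDual ℂ G, Φ (γ.comp S) = γ g := by
  obtain ⟨r, hr, hΦr⟩ : ∃ r : ℝ, 0 < r ∧ ‖Φ‖ ≤ r := ⟨‖Φ‖ + 1, by positivity, by simp⟩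
  have hr' : (r : ℂ) ≠ 0 := by exact_mod_cast hr.ne'
  obtain ⟨g, hg⟩ := hS.exists_forall_apply_comp_eq_of_norm_le_one ((r : ℂ)⁻¹ • Φ) <| by
    refine ContinuousLinearMap.opNorm_le_bound _ zero_le_one fun φ => ?_
    have := Φ.le_of_opNorm_le hΦr φ
    change ‖(r : ℂ)⁻¹ * Φ φ‖ ≤ _
    rw [norm_mul, norm_inv, Complex.norm_of_nonneg hr.le, inv_mul_le_iff₀ hr, one_mul]
    exact this
  refine ⟨(r : ℂ) • g, fun γ => ?_⟩
  rw [map_smul, ← hg]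
  exact (mul_inv_cancel_left₀ hr' _).symm

theorem LinearIsometry.exists_strongDual_apply_eq {F G : Type*} [NormedAddCommGroup F]
    [NormedSpace ℂ F] [NormedAddCommGroup G] [NormedSpace ℂ G] (J : F →ₗᵢ[ℂ] G)
    (φ : StrongDual ℂ F) : ∃ ψ : StrongDual ℂ G, ∀ x, ψ (J x) = φ x := by
  obtain ⟨ψ, hψ, -⟩ := exists_extension_norm_eq (LinearMap.range J.toLinearMap)
    (φ.comp J.equivRange.symm.toContinuousLinearEquiv.toContinuousLinearMap)
  refine ⟨ψ, fun x => (hψ (J.equivRange x)).trans ?_⟩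
  exact congrArg φ (J.equivRange.symm_apply_apply x)

theorem RelWeaklyCompact.of_image {F G : Type*} [NormedAddCommGroup F] [NormedSpace ℂ F]
    [CompleteSpace F] [NormedAddCommGroup G] [NormedSpace ℂ G] (J : F →ₗᵢ[ℂ] G) {s : Set F}
    (hs : RelWeaklyCompact (J '' s)) : RelWeaklyCompact s := by
  let R : WeakSpace ℂ F →L[ℂ] WeakSpace ℂ G := WeakSpace.map J.toContinuousLinearMap
  have hR : Topology.IsClosedEmbedding R := by
    refine ⟨⟨⟨le_antisymm R.continuous.le_induced ?_⟩, J.injective⟩, ?_⟩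
    · refine continuous_id_iff_le.1 ?_
      let t : TopologicalSpace (WeakSpace ℂ F) := .induced R inferInstance
      refine WeakBilin.continuous_of_continuous_eval (topDualPairing ℂ F).flip fun φ => ?_
      obtain ⟨ψ, hψ⟩ := J.exists_strongDual_apply_eq φ
      refine Continuous.congr ((continuous_strongDual_toWeakSpace_symm ψ).comp
        continuous_induced_dom) hψ
    · have hconv : Convex ℝ (Set.range J) := by
        rw [← Set.image_univ]
        exact convex_univ.is_linear_image (J.toLinearMap.restrictScalars ℝ).isLinear
      have hcl := hconv.toWeakSpace_closure ℂ
      rw [J.isometry.isClosedEmbedding.isClosed_range.closure_eq] at hcl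
      have hrange : Set.range R = toWeakSpace ℂ G '' Set.range J := by
        rw [← Set.range_comp]; rfl
      rw [hrange, hcl]
      exact isClosed_closure
  refine (hR.isCompact_preimage hs).of_isClosed_subset isClosed_closure ?_
  refine closure_minimal ?_ (isClosed_closure.preimage R.continuous)
  rintro _ ⟨x, hx, rfl⟩
  exact subset_closure ⟨J x, ⟨x, hx, rfl⟩, rfl⟩

open Filter Topology in
theorem exists_mem_convexHull_norm_lt {X : Type*} [TopologicalSpace X] [CompactSpace X]
    [T2Space X] (g : ℕ → C(X, ℂ)) (M : ℝ) (hM : ∀ n x, ‖g n x‖ ≤ M)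
    (hg : ∀ x, Tendsto (fun n => g n x) atTop (𝓝 0)) {ε : ℝ} (hε : 0 < ε) :
    ∃ p ∈ convexHull ℝ (Set.range g), ‖p‖ < ε := by
  by_contra! hp
  let C : Set C(X, ℝ) := {h | ∃ p ∈ convexHull ℝ (Set.range g), ∀ x, ‖p x‖ ≤ h x}
  have hC : Convex ℝ C := by
    rintro h ⟨p, hpc, hph⟩ h' ⟨q, hqc, hqh⟩ a b ha hb hab
    refine ⟨a • p + b • q, convex_convexHull ℝ _ hpc hqc ha hb hab, fun x => ?_⟩
    calc ‖(a • p + b • q) x‖ ≤ ‖a • p x‖ + ‖b • q x‖ := norm_add_le _ _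
      _ = a * ‖p x‖ + b * ‖q x‖ := by
        rw [norm_smul, norm_smul, Real.norm_of_nonneg ha, Real.norm_of_nonneg hb]
      _ ≤ a * h x + b * h' x := by gcongr <;> solve_by_elim
  have hdisj : Disjoint (Metric.ball (0 : C(X, ℝ)) ε) C := by
    rw [Set.disjoint_left]
    rintro h hh ⟨p, hpc, hph⟩
    rw [mem_ball_zero_iff] at hh
    refine (hp p hpc).not_gt (lt_of_le_of_lt ?_ hh)
    refine (ContinuousMap.norm_le _ (norm_nonneg h)).2 fun x => (hph x).trans ?_
    exact (le_abs_self _).trans (h.norm_coe_le_norm x)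
  obtain ⟨Λ, s, hball, hΛC⟩ :=
    geometric_hahn_banach_open (convex_ball _ _) Metric.isOpen_ball hC hdisj
  have hs : 0 < s := by simpa using hball 0 (Metric.mem_ball_self hε)
  let a : ℕ → C(X, ℝ) := fun n => ⟨fun x => ‖g n x‖, by fun_prop⟩
  have ha (n) : a n ∈ C := ⟨g n, subset_convexHull ℝ _ ⟨n, rfl⟩, fun x => le_rfl⟩
  have hpos (h : C(X, ℝ)) (hh : 0 ≤ h) : 0 ≤ Λ h := by
    by_contra! hneg
    have hmem (t : ℝ) (ht : 0 ≤ t) : a 0 + t • h ∈ C :=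
      ⟨g 0, subset_convexHull ℝ _ ⟨0, rfl⟩,
        fun x => le_add_of_nonneg_right (mul_nonneg ht (hh x))⟩
    have h0 : 0 ≤ Λ (a 0) := hs.le.trans (hΛC _ (ha 0))
    have := hΛC _ (hmem (Λ (a 0) / (-Λ h)) (div_nonneg h0 (by linarith)))
    rw [map_add, map_smul, smul_eq_mul, div_neg, neg_mul, div_mul_cancel₀ _ hneg.ne] at this
    linarith
  let _ : MeasurableSpace X := borel X
  have : BorelSpace X := ⟨rfl⟩
  let L : CompactlySupportedContinuousMap X ℝ →ₚ[ℝ] ℝ := PositiveLinearMap.mk₀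
    { toFun := fun h => Λ (h : C(X, ℝ))
      map_add' := fun x y => map_add Λ (x : C(X, ℝ)) (y : C(X, ℝ))
      map_smul' := fun c x => map_smul Λ c (x : C(X, ℝ)) } fun h hh => hpos _ hh
  have hint (n) : ∫ x, ‖g n x‖ ∂(RealRMK.rieszMeasure L) = Λ (a n) :=
    RealRMK.integral_rieszMeasure L (CompactlySupportedContinuousMap.continuousMapEquiv (a n))
  have hlim : Tendsto (fun n => ∫ x, ‖g n x‖ ∂(RealRMK.rieszMeasure L)) atTop (𝓝 0) := by
    have := MeasureTheory.tendsto_integral_of_dominated_convergence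
      (μ := RealRMK.rieszMeasure L) (F := fun n x => ‖g n x‖) (f := fun _ => (0 : ℝ))
      (fun _ => M) (fun n => (a n).continuous.aestronglyMeasurable)
      (MeasureTheory.integrable_const M) (fun n => .of_forall fun x => by simpa using hM n x)
      (.of_forall fun x => by simpa using (hg x).norm)
    simpa using this
  exact hs.not_ge (ge_of_tendsto' hlim fun n => (hint n).symm ▸ hΛC _ (ha n))

theorem exists_norm_le_one_apply_eq_of_forall_eq_zero {F : Type*} [NormedAddCommGroup F]
    [NormedSpace ℂ F] (ξ : StrongDual ℂ (StrongDual ℂ F)) {d : ℝ} (hd : 0 < d)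
    (hξ : ∀ x, d < ‖ξ - NormedSpace.inclusionInDoubleDual ℂ F x‖) (S : Set F) (hS : S.Finite) :
    ∃ φ : StrongDual ℂ F, ‖φ‖ ≤ 1 ∧ ξ φ = d ∧ ∀ x ∈ S, φ x = 0 := by
  have := hS.to_subtype
  let J := NormedSpace.inclusionInDoubleDual ℂ F
  let N : Submodule ℂ (StrongDual ℂ F) := ⨅ x : S, LinearMap.ker (J x).toLinearMap
  have hN {φ} : φ ∈ N ↔ ∀ x ∈ S, φ x = 0 := by simp [N, J]
  by_contra! hno
  have hle (φ : N) : ‖(ξ.comp N.subtypeL) φ‖ ≤ d * ‖φ‖ := by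
    by_contra! hlt
    change d * ‖(φ : StrongDual ℂ F)‖ < ‖ξ φ‖ at hlt
    have h0 : 0 < ‖ξ φ‖ := lt_of_le_of_lt (by positivity) hlt
    obtain ⟨x, hx, hne⟩ := hno (((d : ℂ) / ξ φ) • (φ : StrongDual ℂ F)) (by
      rw [norm_smul, norm_div, Complex.norm_of_nonneg hd.le, div_mul_eq_mul_div, div_le_one h0]
      exact hlt.le) (by
      rw [map_smul, smul_eq_mul, div_mul_cancel₀ _ (norm_pos_iff.1 h0)])
    exact hne (by simp [hN.1 φ.2 x hx])
  obtain ⟨η, hη, hηn⟩ := exists_extension_norm_eq N (ξ.comp N.subtypeL)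
  have hspan : (ξ - η).toLinearMap ∈
      Submodule.span ℂ (Set.range fun x : S => (J x).toLinearMap) :=
    mem_span_of_iInf_ker_le_ker fun φ hφ => by
      have := hη ⟨φ, hφ⟩
      simp at this
      simp [this]
  obtain ⟨x, hx⟩ := (Submodule.span_le (p := LinearMap.range
      ((ContinuousLinearMap.coeLM ℂ).comp J.toLinearMap))).2
    (by rintro _ ⟨x, rfl⟩; exact ⟨x, rfl⟩) hspan
  have hxη : ξ - J x = η := by
    ext φ
    have : J x φ = ξ φ - η φ := LinearMap.congr_fun hx φ
    simp [this]
  refine (hξ x).not_ge ?_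
  change ‖ξ - J x‖ ≤ d
  rw [hxη, hηn]
  exact ContinuousLinearMap.opNorm_le_bound _ hd.le hle

open Filter Topology in
theorem tendsto_apply_zero_of_mem_closure_span {F : Type*} [NormedAddCommGroup F]
    [NormedSpace ℂ F] {φ : ℕ → StrongDual ℂ F} (hφ : ∀ n, ‖φ n‖ ≤ 1) {s : Set F}
    (hs : ∀ x ∈ s, ∀ᶠ n in atTop, φ n x = 0) {x : F}
    (hx : x ∈ closure (Submodule.span ℂ s : Set F)) :
    Tendsto (fun n => φ n x) atTop (𝓝 0) := by
  have hspan : ∀ y ∈ Submodule.span ℂ s, ∀ᶠ n in atTop, φ n y = 0 := fun y hy => by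
    induction hy using Submodule.span_induction with
    | mem y hy => exact hs y hy
    | zero => simp
    | add y z _ _ hy hz => filter_upwards [hy, hz] with n h1 h2; simp [h1, h2]
    | smul c y _ hy => filter_upwards [hy] with n h; simp [h]
  rw [Metric.tendsto_nhds]
  intro ε hε
  obtain ⟨y, hy, hxy⟩ := Metric.mem_closure_iff.1 hx ε hε
  filter_upwards [hspan y hy] with n hn
  calc dist (φ n x) 0 = ‖φ n (x - y)‖ := by simp [hn]
    _ ≤ 1 * ‖x - y‖ := (φ n).le_of_opNorm_le (hφ n) _
    _ < ε := by rwa [one_mul, ← dist_eq_norm]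

theorem LinearIsometry.exists_pos_forall_lt_norm_sub {F G : Type*} [NormedAddCommGroup F]
    [NormedSpace ℂ F] [CompleteSpace F] [NormedAddCommGroup G] [NormedSpace ℂ G]
    (J : F →ₗᵢ[ℂ] G) {ξ : G} (hξ : ξ ∉ Set.range J) :
    ∃ d : ℝ, 0 < d ∧ ∀ x, d < ‖ξ - J x‖ := by
  obtain ⟨ε, hε, hball⟩ := Metric.isOpen_iff.1
    J.isometry.isClosedEmbedding.isClosed_range.isOpen_compl ξ hξ
  refine ⟨ε / 2, half_pos hε, fun x => ?_⟩
  by_contra! hle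
  refine hball (a := J x) ?_ ⟨x, rfl⟩
  rw [Metric.mem_ball, dist_comm, dist_eq_norm]
  exact hle.trans_lt (half_lt_self hε)

theorem LinearIsometryEquiv.exists_linearIsometry_strongDual {F D : Type*} [NormedAddCommGroup F]
    [NormedSpace ℂ F] [NormedAddCommGroup D] [NormedSpace ℂ D] (ι : D ≃ₗᵢ[ℂ] StrongDual ℂ F) :
    ∃ J : F →ₗᵢ[ℂ] StrongDual ℂ D, ∀ x φ, J x φ = ι φ x := by
  have hle (x : F) (φ : D) : ‖ι φ x‖ ≤ ‖x‖ * ‖φ‖ := by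
    rw [mul_comm, ← ι.norm_map]
    exact (ι φ).le_opNorm x
  let L : F →ₗ[ℂ] StrongDual ℂ D :=
    { toFun := fun x => LinearMap.mkContinuous
        { toFun := fun φ => ι φ x
          map_add' := fun φ ψ => by simp
          map_smul' := fun c φ => by simp } ‖x‖ (hle x)
      map_add' := fun x y => by ext φ; exact (ι φ).map_add x y
      map_smul' := fun c x => by ext φ; exact (ι φ).map_smul c x }
  refine ⟨⟨L, fun x => le_antisymm
    ((L x).opNorm_le_bound (norm_nonneg x) (hle x)) ?_⟩, fun _ _ => rfl⟩
  obtain ⟨φ, hφ, hφx⟩ := exists_dual_vector'' ℂ x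
  have hL := (L x).le_opNorm (ι.symm φ)
  rw [ι.symm.norm_map, show L x (ι.symm φ) = φ x from congrArg (fun ψ => ψ x)
    (ι.apply_symm_apply φ), hφx, RCLike.norm_ofReal, abs_norm] at hL
  exact hL.trans (mul_le_of_le_one_right (norm_nonneg _) hφ)

theorem LinearIsometryEquiv.exists_pos_forall_lt_norm_sub {F D : Type*} [NormedAddCommGroup F]
    [NormedSpace ℂ F] [CompleteSpace F] [NormedAddCommGroup D] [NormedSpace ℂ D]
    (ι : D ≃ₗᵢ[ℂ] StrongDual ℂ F) {ξ : StrongDual ℂ D} (hξ : ∀ x, ∃ φ, ξ φ ≠ ι φ x) :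
    ∃ d : ℝ, 0 < d ∧ ∀ x, ∀ ψ : StrongDual ℂ D, (∀ φ, ψ φ = ι φ x) → d < ‖ξ - ψ‖ := by
  obtain ⟨J, hJ⟩ := ι.exists_linearIsometry_strongDual
  obtain ⟨d, hd, h⟩ := J.exists_pos_forall_lt_norm_sub (ξ := ξ) <| by
    rintro ⟨x, rfl⟩
    obtain ⟨φ, hφ⟩ := hξ x
    exact hφ (hJ x φ)
  refine ⟨d, hd, fun x ψ hψ => ?_⟩
  rw [show ψ = J x by ext φ; rw [hψ, hJ]]
  exact h x

/-- If `S : F* → G` is weakly compact, then every subset of `F` whose evaluations are transposes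
under `S` of functionals in the unit ball of `G*` is relatively weakly compact. -/
theorem WeaklyCompactOperator.relWeaklyCompact_of_forall_exists {F D G : Type*}
    [NormedAddCommGroup F] [NormedSpace ℂ F] [CompleteSpace F] [NormedAddCommGroup D]
    [NormedSpace ℂ D] [NormedAddCommGroup G] [NormedSpace ℂ G] {S : D →L[ℂ] G}
    (hS : WeaklyCompactOperator S) (ι : D ≃ₗᵢ[ℂ] StrongDual ℂ F) {s : Set F}
    (h : ∀ x ∈ s, ∃ γ : StrongDual ℂ G, ‖γ‖ ≤ 1 ∧ ∀ φ, γ (S φ) = ι φ x) :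
    RelWeaklyCompact s := by
  obtain ⟨J, hJ⟩ := ι.exists_linearIsometry_strongDual
  let S' : StrongDual ℂ G →L[ℂ] StrongDual ℂ D := S.precomp ℂ
  have hS' : WeaklyCompactOperator S' :=
    weaklyCompactOperator_of_forall_exists_eval S' hS.exists_forall_apply_comp_eq
  refine RelWeaklyCompact.of_image J
    (IsCompact.of_isClosed_subset hS' isClosed_closure (closure_mono (Set.image_mono ?_)))
  rintro _ ⟨x, hx, rfl⟩
  obtain ⟨γ, hγ, hγx⟩ := h x hx
  refine ⟨γ, mem_closedBall_zero_iff.2 hγ, ?_⟩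
  ext φ
  rw [hJ]
  exact hγx φ

open Filter Topology in
/-- A form of Krein's theorem: a functional on bounded continuous functions, integrated against a
map `f` with relatively weakly compact range, is represented by an element of the space. -/
theorem exists_forall_apply_eq_of_relWeaklyCompact_range {X F : Type*} [TopologicalSpace X]
    [NormedAddCommGroup F] [NormedSpace ℂ F] [CompleteSpace F] {f : X → F} {M : ℝ}
    (hM : ∀ x, ‖f x‖ ≤ M) (hf : RelWeaklyCompact (Set.range f))
    (T : StrongDual ℂ F →L[ℂ] BoundedContinuousFunction X ℂ) (hT : ∀ φ x, T φ x = φ (f x))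
    (γ : StrongDual ℂ (BoundedContinuousFunction X ℂ)) : ∃ x : F, ∀ φ, γ (T φ) = φ x := by
  classical
  let ξ : StrongDual ℂ (StrongDual ℂ F) := γ.comp T
  by_contra! hno
  obtain ⟨d, hd, hξd⟩ : ∃ d : ℝ, 0 < d ∧
      ∀ x, d < ‖ξ - NormedSpace.inclusionInDoubleDual ℂ F x‖ := by
    obtain ⟨d, hd, h⟩ := (LinearIsometryEquiv.refl ℂ (StrongDual ℂ F)).exists_pos_forall_lt_norm_sub
      (ξ := ξ) hno
    exact ⟨d, hd, fun x => h x (NormedSpace.inclusionInDoubleDual ℂ F x) fun _ => rfl⟩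
  obtain ⟨δ, hδ, hTδ⟩ : ∃ δ : ℝ, 0 < δ ∧ ∀ φ, ξ φ = d → δ < ‖T φ‖ := by
    refine ⟨d / (‖γ‖ + 1), by positivity, fun φ hφ => ?_⟩
    have h1 : d ≤ ‖γ‖ * ‖T φ‖ := by
      have := γ.le_opNorm (T φ)
      rwa [show γ (T φ) = d from hφ, Complex.norm_of_nonneg hd.le] at this
    have h2 : 0 < ‖T φ‖ := by
      refine (norm_nonneg _).lt_of_ne fun h => ?_
      rw [← h, mul_zero] at h1
      exact h1.not_gt hd
    rw [div_lt_iff₀ (by positivity)]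
    linarith
  have hnorming (A : Finset (StrongDual ℂ F)) : ∃ S : Finset X, (∀ φ ∈ A, ξ φ = d) →
      ∀ φ ∈ convexHull ℝ (A : Set (StrongDual ℂ F)), ∃ x ∈ S, δ < ‖φ (f x)‖ := by
    by_cases hA : ∀ φ ∈ A, ξ φ = d
    · have hconv : convexHull ℝ (A : Set (StrongDual ℂ F)) ⊆ {φ | ξ φ = d} := by
        refine convexHull_min hA fun φ hφ ψ hψ a b _ _ hab => ?_
        change ξ (a • φ + b • ψ) = d
        rw [map_add, ξ.map_smul_of_tower, ξ.map_smul_of_tower, show ξ φ = d from hφ,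
          show ξ ψ = d from hψ, ← add_smul, hab, one_smul]
      obtain ⟨S, hS⟩ := (A.finite_toSet.isCompact_convexHull ℝ).elim_finite_subcover
        (fun x : X => {φ : StrongDual ℂ F | δ < ‖φ (f x)‖})
        (fun x => isOpen_lt continuous_const (by fun_prop)) fun φ hφ => by
          by_contra hx
          simp only [Set.mem_iUnion, Set.mem_ofPred_eq, not_exists, not_lt] at hx
          refine (hTδ φ (hconv hφ)).not_ge ?_
          exact (BoundedContinuousFunction.norm_le hδ.le).2 fun x => (hT φ x).symm ▸ hx x
      exact ⟨S, fun _ φ hφ => by simpa using hS hφ⟩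
    · exact ⟨∅, fun h => (hA h).elim⟩
  choose S hS using hnorming
  have hstep (A : Finset (StrongDual ℂ F)) : ∃ φ : StrongDual ℂ F, ‖φ‖ ≤ 1 ∧ ξ φ = d ∧
      ∀ B ⊆ A, ∀ x ∈ S B, φ (f x) = 0 := by
    obtain ⟨φ, h1, h2, h3⟩ := exists_norm_le_one_apply_eq_of_forall_eq_zero ξ hd hξd
      (f '' (A.powerset.biUnion S)) ((Finset.finite_toSet _).image f)
    refine ⟨φ, h1, h2, fun B hB x hx => h3 _ ⟨x, ?_, rfl⟩⟩
    exact Finset.mem_biUnion.2 ⟨B, Finset.mem_powerset.2 hB, hx⟩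
  choose Φ hΦ1 hΦd hΦ0 using hstep
  obtain ⟨A, hA0, hAs⟩ : ∃ A : ℕ → Finset (StrongDual ℂ F), A 0 = ∅ ∧
      ∀ n, A (n + 1) = insert (Φ (A n)) (A n) :=
    ⟨fun n => Nat.rec ∅ (fun _ B => insert (Φ B) B) n, rfl, fun _ => rfl⟩
  have hAmono : Monotone A := monotone_nat_of_le_succ fun n => hAs n ▸ Finset.subset_insert _ _
  have hAd (n) : ∀ φ ∈ A n, ξ φ = d := by
    induction n with
    | zero => simp [hA0]
    | succ n ih => exact hAs n ▸ Finset.forall_mem_insert _ _ _ |>.2 ⟨hΦd _, ih⟩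
  let K : Set (WeakSpace ℂ F) := closure (toWeakSpace ℂ F '' Set.range f)
  let s : Set F := ⋃ n, f '' S (A n)
  let Y : Set (WeakSpace ℂ F) :=
    K ∩ toWeakSpace ℂ F '' closure (Submodule.span ℂ s : Set F)
  have hY : IsCompact Y := by
    refine IsCompact.inter_right hf ?_
    have hconv : Convex ℝ (Submodule.span ℂ s : Set F) :=
      ((Submodule.span ℂ s).restrictScalars ℝ).convex
    rw [hconv.toWeakSpace_closure ℂ]
    exact isClosed_closure
  have : CompactSpace Y := isCompact_iff_compactSpace.1 hY
  let R : StrongDual ℂ F →ₗ[ℝ] C(Y, ℂ) :=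
    { toFun := fun φ => ⟨fun y => φ ((toWeakSpace ℂ F).symm y),
        (continuous_strongDual_toWeakSpace_symm φ).comp continuous_subtype_val⟩
      map_add' := fun _ _ => rfl
      map_smul' := fun _ _ => rfl }
  have hbound (φ : StrongDual ℂ F) (hφ : ‖φ‖ ≤ 1) (y : Y) : ‖R φ y‖ ≤ M := by
    have hKsub : K ⊆ {x | ‖φ ((toWeakSpace ℂ F).symm x)‖ ≤ M} := by
      refine closure_minimal ?_
        (isClosed_le (continuous_strongDual_toWeakSpace_symm φ).norm continuous_const)
      rintro _ ⟨_, ⟨x, rfl⟩, rfl⟩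
      exact (φ.le_of_opNorm_le hφ _).trans ((one_mul _).trans_le (hM x))
    exact hKsub y.2.1
  have htendsto (y : Y) : Tendsto (fun n => R (Φ (A n)) y) atTop (𝓝 0) := by
    obtain ⟨x, hx, hxy⟩ := y.2.2
    have := tendsto_apply_zero_of_mem_closure_span (φ := fun n => Φ (A n))
      (fun n => hΦ1 _) (s := s) (fun z hz => ?_) hx
    · rwa [← (toWeakSpace ℂ F).symm_apply_apply x, hxy] at this
    · obtain ⟨n, x, hx, rfl⟩ := Set.mem_iUnion.1 hz
      filter_upwards [eventually_ge_atTop n] with m hm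
      exact hΦ0 _ _ (hAmono hm) x hx
  obtain ⟨p, hp, hpδ⟩ := exists_mem_convexHull_norm_lt (fun n => R (Φ (A n))) M
    (fun n => hbound _ (hΦ1 _)) htendsto hδ
  rw [show (fun n => R (Φ (A n))) = R ∘ fun n => Φ (A n) from rfl, Set.range_comp,
    ← R.image_convexHull] at hp
  obtain ⟨ψ, hψ, rfl⟩ := hp
  obtain ⟨n, hn⟩ : ∃ n, ψ ∈ convexHull ℝ (A n : Set (StrongDual ℂ F)) := by
    refine Set.mem_iUnion.1 (convexHull_min ?_ (Directed.convex_iUnion ?_ fun n =>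
      convex_convexHull ℝ (A n : Set (StrongDual ℂ F))) hψ)
    · rintro _ ⟨n, rfl⟩
      exact Set.mem_iUnion.2 ⟨n + 1, subset_convexHull ℝ _ (hAs n ▸ Finset.mem_insert_self _ _)⟩
    · exact Monotone.directed_le fun m n h => convexHull_mono (hAmono h)
  obtain ⟨x, hx, hxδ⟩ := hS (A n) (hAd n) ψ hn
  have hxs : f x ∈ s := Set.mem_iUnion.2 ⟨n, x, hx, rfl⟩
  let y : Y := ⟨toWeakSpace ℂ F (f x), subset_closure ⟨f x, ⟨x, rfl⟩, rfl⟩,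
    f x, subset_closure (Submodule.subset_span hxs), rfl⟩
  exact (((R ψ).norm_coe_le_norm y).trans_lt hpδ).not_gt hxδ

/-- A bounded holomorphic mapping `f : U → F` has relatively weakly compact
range iff its transpose `f^t : F* → H^∞(U)`, `f^t(y*) = y* ∘ f`, is a weakly compact bounded
linear operator. (We realize `H^∞(U)` inside the bounded continuous functions on `U` with the
sup norm; the transpose is the continuous linear operator `T` determined by
`T φ x = φ (f x)` for `φ ∈ F*` and `x ∈ U`.) -/
theorem stmt_17 {E F : Type*} [NormedAddCommGroup E] [NormedSpace ℂ E] [CompleteSpace E]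
    [NormedAddCommGroup F] [NormedSpace ℂ F] [CompleteSpace F]
    (U : Set E) (hU : IsOpen U) (hne : U.Nonempty)
    (f : E → F) (hf : DifferentiableOn ℂ f U) (hb : Bornology.IsBounded (f '' U))
    (T : (F →L[ℂ] ℂ) →L[ℂ] BoundedContinuousFunction U ℂ)
    (hT : ∀ (φ : F →L[ℂ] ℂ) (x : U), T φ x = φ (f x)) :
    RelWeaklyCompact (f '' U) ↔ WeaklyCompactOperator T := by
  have hrange : Set.range (fun x : U => f x) = f '' U := (Set.image_eq_range f U).symm
  constructor
  · intro h
    obtain ⟨M, hM⟩ := hb.exists_norm_le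
    exact weaklyCompactOperator_of_forall_exists_eval T
      (exists_forall_apply_eq_of_relWeaklyCompact_range
        (fun x : U => hM _ (Set.mem_image_of_mem f x.2)) (hrange ▸ h) T hT)
  · intro h
    refine h.relWeaklyCompact_of_forall_exists (LinearIsometryEquiv.refl ℂ _) ?_
    rintro _ ⟨x, hx, rfl⟩
    refine ⟨BoundedContinuousFunction.evalCLM ℂ (⟨x, hx⟩ : U), ?_, fun φ => hT φ ⟨x, hx⟩⟩
    refine ContinuousLinearMap.opNorm_le_bound _ zero_le_one fun g => ?_
    rw [one_mul]
    exact g.norm_coe_le_norm _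
end
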